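/- For every J ⊆ 𝒥 and j ∈ 𝒥: if j+1 ∉ J Δ (J−1)^{ss} then s^J_j = s^{(J−1)^{ss}}_j + 1_{j ∈ J Δ (J−1)^{ss}}, and if j+1 ∈ J Δ (J−1)^{ss} then s^J_j = p − 2 − s^{(J−1)^{ss}}_j + 1_{j ∈ J Δ (J−1)^{ss}}. -/

import Mathlib

open Finset
open scoped symmDiff

def shiftSet (f : ℕ) (J : Finset (ZMod f)) (k : ℤ) : Finset (ZMod f) :=
  J.image (fun j => j + (k : ZMod f))

def deltaSS (f : ℕ) (Jrho J : Finset (ZMod f)) : Finset (ZMod f) :=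
  shiftSet f J (-1) ∩ Jrho

def sfun (p f : ℕ) (r : ZMod f → ℤ) (Jrho J : Finset (ZMod f)) (j : ZMod f) : ℤ :=
  if j ∈ J then
    if j + 1 ∈ J then (if j ∈ Jrho then (p : ℤ) - 3 - r j else (p : ℤ) - 1 - r j)
    else r j + 1
  else
    if j + 1 ∈ J then (p : ℤ) - 2 - r j else r j

def tfun (f : ℕ) (r : ZMod f → ℤ) (Jrho J : Finset (ZMod f)) (j : ZMod f) : ℤ :=
  if j ∈ J then
    if j + 1 ∈ J then (if j ∈ Jrho then r j + 1 else r j)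
    else -1
  else
    if j + 1 ∈ J then r j + 1 else 0


theorem mem_deltaSS (f : ℕ) (Jrho J : Finset (ZMod f)) (j : ZMod f) :
    j ∈ deltaSS f Jrho J ↔ j + 1 ∈ J ∧ j ∈ Jrho := by
  simp [deltaSS, shiftSet, ← sub_eq_add_neg, sub_eq_iff_eq_add]

/-- comparison of `s^J_j` with `s^{(J−1)^{ss}}_j`. -/
theorem statement1 (p f : ℕ) [NeZero f] (hp : p.Prime) (hf : 1 ≤ f)
    (r : ZMod f → ℤ)
    (hr : ∀ j, max 12 (2 * (f : ℤ) + 1) ≤ r j ∧ r j ≤ (p : ℤ) - max 15 (2 * (f : ℤ) + 3))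
    (Jrho : Finset (ZMod f)) :
    ∀ (J : Finset (ZMod f)) (j : ZMod f),
      (j + 1 ∉ J ∆ deltaSS f Jrho J →
        sfun p f r Jrho J j =
          sfun p f r Jrho (deltaSS f Jrho J) j +
            (if j ∈ J ∆ deltaSS f Jrho J then 1 else 0)) ∧
      (j + 1 ∈ J ∆ deltaSS f Jrho J →
        sfun p f r Jrho J j =
          (p : ℤ) - 2 - sfun p f r Jrho (deltaSS f Jrho J) j +
            (if j ∈ J ∆ deltaSS f Jrho J then 1 else 0)) := by
  intro J j
  have hj := mem_deltaSS f Jrho J j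
  by_cases ha : j ∈ J <;> by_cases hb : j + 1 ∈ J <;> by_cases hρ : j ∈ Jrho <;>
    by_cases hc : j + 1 ∈ deltaSS f Jrho J <;>
    simp [sfun, Finset.mem_symmDiff, hj, ha, hb, hρ, hc] <;> ring
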